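/- arXiv:2207.02617 — 2 statements merged into one kernel-verified Lean document; each statement's English description precedes it below -/
import Mathlib

section
/- Fix R > 0 and x₀ ∈ ℝⁿ, assume h(x,R) ∈ (0,∞) for all relevant x, and define ũ(x) := u(Rx + x₀), ν̃(x,r) := Rⁿ ν(Rx + x₀, Rr)/h(Rx + x₀, R), and f̃(x) := f(Rx + x₀)/h(Rx + x₀, R). Then: (a) if u is a viscosity subsolution of M⁺_ν u = f in B_R(x₀), then ũ is a viscosity subsolution of M⁺_{ν̃} ũ = f̃ in B₁; (b) the function h̃ built from ν̃ satisfies h̃(x,s) = h(Rx + x₀, Rs)/h(Rx + x₀, R), and consequently ν̃ always satisfies (A1); if ν satisfies (A2) then so does ν̃; if ν satisfies (A3) with constants c_U, α then so does ν̃ with the same constants; and if ν satisfies (B) with constant c* then so does ν̃ with the same constant. -/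
open MeasureTheory Metric Set
open scoped ENNReal

noncomputable section

/-- Euclidean space `ℝⁿ`. -/
abbrev Eucl (n : ℕ) := EuclideanSpace ℝ (Fin n)

/-- Second-order difference `δ(u,x,y) = u(x+y) + u(x−y) − 2u(x)`. -/
def delta2 (n : ℕ) (u : Eucl n → ℝ) (x y : Eucl n) : ℝ :=
  u (x + y) + u (x - y) - 2 * u x

/-- `h(x,r) = ∫ min(1, |y|²/r²) ν(x,|y|) dy`. -/
def hfun (n : ℕ) (ν : Eucl n → ℝ → ℝ) (x : Eucl n) (r : ℝ) : ℝ :=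
  ∫ y : Eucl n, min 1 (‖y‖ ^ 2 / r ^ 2) * ν x ‖y‖

/-- `K(x,r) = r⁻² ∫_{|y|<r} |y|² ν(x,|y|) dy`. -/
def Kfun (n : ℕ) (ν : Eucl n → ℝ → ℝ) (x : Eucl n) (r : ℝ) : ℝ :=
  (∫ y in Metric.ball (0 : Eucl n) r, ‖y‖ ^ 2 * ν x ‖y‖) / r ^ 2

/-- Standing assumptions on the kernel: measurability, nonnegativity,
integrability of `min(1,|y|²) ν(x,|y|)`. -/
def KernelOK (n : ℕ) (ν : Eucl n → ℝ → ℝ) : Prop :=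
  Measurable (Function.uncurry ν) ∧ (∀ x r, 0 < r → 0 ≤ ν x r) ∧
    ∀ x : Eucl n, Integrable (fun y : Eucl n => min 1 (‖y‖ ^ 2) * ν x ‖y‖)

/-- (A1) `h(x,1) = 1`. -/
def CondA1 (n : ℕ) (ν : Eucl n → ℝ → ℝ) : Prop := ∀ x, hfun n ν x 1 = 1

/-- (A2) `r ↦ ν(x,r)` is nonincreasing. -/
def CondA2 (n : ℕ) (ν : Eucl n → ℝ → ℝ) : Prop :=
  ∀ (x : Eucl n) (s r : ℝ), 0 < s → s ≤ r → ν x r ≤ ν x s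

/-- (A3) the weak scaling condition. -/
def CondA3 (n : ℕ) (ν : Eucl n → ℝ → ℝ) (cU α : ℝ) : Prop :=
  ∀ (x : Eucl n) (r t : ℝ), 0 < r → 1 ≤ t →
    hfun n ν x (t * r) ≤ cU * t ^ (-α) * hfun n ν x r

/-- Condition (A). -/
def CondA (n : ℕ) (ν : Eucl n → ℝ → ℝ) (cU α : ℝ) : Prop :=
  CondA1 n ν ∧ CondA2 n ν ∧ CondA3 n ν cU α

/-- Condition (B): `ν(x₁,r)/h(x₁,s) ≤ c* ν(x₂,r)/h(x₂,s)` for `|x₁−x₂| ≤ s ≤ r`. -/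
def CondB (n : ℕ) (ν : Eucl n → ℝ → ℝ) (cs : ℝ) : Prop :=
  ∀ (x₁ x₂ : Eucl n) (s r : ℝ), 0 < s → dist x₁ x₂ ≤ s → s ≤ r →
    ν x₁ r * hfun n ν x₂ s ≤ cs * (ν x₂ r * hfun n ν x₁ s)

/-- Maximal Pucci-type operator `M⁺_ν`. -/
def Mplus (n : ℕ) (lam Lam : ℝ) (ν : Eucl n → ℝ → ℝ) (u : Eucl n → ℝ) (x : Eucl n) : ℝ :=
  ∫ y : Eucl n, (Lam * max (delta2 n u x y) 0 - lam * max (-delta2 n u x y) 0) * ν x ‖y‖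

/-- Minimal Pucci-type operator `M⁻_ν`. -/
def Mminus (n : ℕ) (lam Lam : ℝ) (ν : Eucl n → ℝ → ℝ) (u : Eucl n → ℝ) (x : Eucl n) : ℝ :=
  ∫ y : Eucl n, (lam * max (delta2 n u x y) 0 - Lam * max (-delta2 n u x y) 0) * ν x ‖y‖

/-- `C^{1,1}` regularity on a set: differentiable with Lipschitz derivative. -/
def C11On (n : ℕ) (φ : Eucl n → ℝ) (s : Set (Eucl n)) : Prop :=
  DifferentiableOn ℝ φ s ∧
    ∃ L : NNReal, LipschitzOnWith L (fun x => fderivWithin ℝ φ s x) s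

open Classical in
/-- The test function: `φ` on `N`, `u` elsewhere. -/
def replaceOn (n : ℕ) (u φ : Eucl n → ℝ) (N : Set (Eucl n)) : Eucl n → ℝ :=
  fun y => if y ∈ N then φ y else u y

/-- Boundedness on all of `ℝⁿ`. -/
def IsBdd (n : ℕ) (u : Eucl n → ℝ) : Prop := ∃ M, ∀ x, |u x| ≤ M

/-- Viscosity subsolution of `M⁺_ν u = g` in `Ω`. -/
def IsViscositySubsol (n : ℕ) (lam Lam : ℝ) (ν : Eucl n → ℝ → ℝ) (u g : Eucl n → ℝ)
    (Ω : Set (Eucl n)) : Prop :=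
  ∀ x ∈ Ω, ∀ N : Set (Eucl n), IsOpen N → x ∈ N → N ⊆ Ω →
    ∀ φ : Eucl n → ℝ, C11On n φ (closure N) → φ x = u x → (∀ y ∈ N, u y ≤ φ y) →
      g x ≤ Mplus n lam Lam ν (replaceOn n u φ N) x

/-- Viscosity supersolution of `M⁻_ν u = g` in `Ω`. -/
def IsViscositySupersol (n : ℕ) (lam Lam : ℝ) (ν : Eucl n → ℝ → ℝ) (u g : Eucl n → ℝ)
    (Ω : Set (Eucl n)) : Prop :=
  ∀ x ∈ Ω, ∀ N : Set (Eucl n), IsOpen N → x ∈ N → N ⊆ Ω →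
    ∀ φ : Eucl n → ℝ, C11On n φ (closure N) → φ x = u x → (∀ y ∈ N, φ y ≤ u y) →
      Mminus n lam Lam ν (replaceOn n u φ N) x ≤ g x

/-- Open axis-parallel cube `𝒬_l(x)` with center `x` and side length `l`. -/
def cube (n : ℕ) (x : Eucl n) (l : ℝ) : Set (Eucl n) :=
  {y | ∀ i, |y i - x i| < l / 2}

/-- The Pucci-type profile `t ↦ A t⁺ − B t⁻`. -/
def pucci (A B t : ℝ) : ℝ := A * max t 0 - B * max (-t) 0

lemma continuous_pucci (A B : ℝ) : Continuous (pucci A B) := by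
  unfold pucci; fun_prop

lemma abs_pucci_le (A B t : ℝ) : |pucci A B t| ≤ (|A| + |B|) * |t| := by
  have h₁ : |max t 0| ≤ |t| := by
    rw [abs_of_nonneg (le_max_right t 0)]; exact max_le (le_abs_self t) (abs_nonneg t)
  have h₂ : |max (-t) 0| ≤ |t| := by
    rw [abs_of_nonneg (le_max_right (-t) 0)]; exact max_le (neg_le_abs t) (abs_nonneg t)
  calc |pucci A B t| ≤ |A * max t 0| + |B * max (-t) 0| := abs_sub _ _
    _ = |A| * |max t 0| + |B| * |max (-t) 0| := by rw [abs_mul, abs_mul]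
    _ ≤ |A| * |t| + |B| * |t| := by gcongr
    _ = (|A| + |B|) * |t| := by ring

lemma pucci_mul (A B t : ℝ) {w : ℝ} (hw : 0 ≤ w) : pucci A B t * w = pucci A B (t * w) := by
  have h₁ : max (t * w) 0 = max t 0 * w := by rw [max_mul_of_nonneg _ _ hw, zero_mul]
  have h₂ : max (-(t * w)) 0 = max (-t) 0 * w := by
    rw [max_mul_of_nonneg _ _ hw, zero_mul, neg_mul]
  unfold pucci
  rw [h₁, h₂]; ring

lemma pucci_inv_pucci {A B : ℝ} (hA : 0 < A) (hB : 0 < B) (t : ℝ) :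
    pucci A⁻¹ B⁻¹ (pucci A B t) = t := by
  rcases le_total 0 t with ht | ht
  · have h : pucci A B t = A * t := by simp [pucci, ht]
    have h' : 0 ≤ A * t := by positivity
    rw [h, pucci, max_eq_left h', max_eq_right (by linarith)]
    field_simp; simp
  · have h : pucci A B t = B * t := by simp [pucci, ht]
    have h' : B * t ≤ 0 := mul_nonpos_of_nonneg_of_nonpos hB.le ht
    rw [h, pucci, max_eq_right h', max_eq_left (by linarith)]
    field_simp; simp

lemma integrable_pucci {α : Type*} [MeasurableSpace α] {μ : Measure α} (A B : ℝ) {g : α → ℝ}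
    (hg : Integrable g μ) : Integrable (fun y => pucci A B (g y)) μ := by
  refine Integrable.mono' (hg.abs.const_mul (|A| + |B|))
    ((continuous_pucci A B).comp_aestronglyMeasurable hg.aestronglyMeasurable) ?_
  exact Filter.Eventually.of_forall fun y => abs_pucci_le A B (g y)

lemma integrable_pucci_iff {α : Type*} [MeasurableSpace α] {μ : Measure α} {A B : ℝ}
    (hA : 0 < A) (hB : 0 < B) {g : α → ℝ} :
    Integrable (fun y => pucci A B (g y)) μ ↔ Integrable g μ := by
  refine ⟨fun h => ?_, integrable_pucci A B⟩
  simpa only [pucci_inv_pucci hA hB] using integrable_pucci A⁻¹ B⁻¹ h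

lemma Mplus_eq_integral_pucci (n : ℕ) (lam Lam : ℝ) (ν : Eucl n → ℝ → ℝ) (v : Eucl n → ℝ)
    (x : Eucl n) (hν : ∀ r, 0 < r → 0 ≤ ν x r) :
    Mplus n lam Lam ν v x = ∫ y : Eucl n, pucci Lam lam (delta2 n v x y * ν x ‖y‖) := by
  refine integral_congr_ae (Filter.Eventually.of_forall fun y => ?_)
  change pucci Lam lam (delta2 n v x y) * ν x ‖y‖ = _
  rcases eq_or_ne y 0 with rfl | hy
  · have : delta2 n v x 0 = 0 := by simp [delta2]; ring
    simp [this, pucci]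
  · exact pucci_mul _ _ _ (hν _ (norm_pos_iff.2 hy))

lemma abs_delta2_mul_le (n : ℕ) {e : Eucl n → ℝ} {x : Eucl n} {C ρ : ℝ} (hC : ∀ z, |e z| ≤ C)
    (hρ : 0 < ρ) (hρe : ∀ z ∈ ball x ρ, e z = 0) (w : ℝ) (y : Eucl n) :
    |delta2 n e x y * w| ≤ 2 * C * max 1 (ρ ^ 2)⁻¹ * |min 1 (‖y‖ ^ 2) * w| := by
  have hC0 : 0 ≤ C := (abs_nonneg _).trans (hC 0)
  have hex : e x = 0 := hρe x (mem_ball_self hρ)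
  rw [abs_mul, abs_mul, ← mul_assoc]
  refine mul_le_mul_of_nonneg_right ?_ (abs_nonneg w)
  rw [abs_of_nonneg (le_min zero_le_one (sq_nonneg ‖y‖))]
  rcases lt_or_ge ‖y‖ ρ with hy | hy
  · have h₁ : e (x + y) = 0 := hρe _ (by simpa [mem_ball, dist_eq_norm] using hy)
    have h₂ : e (x - y) = 0 := hρe _ (by simpa [mem_ball, dist_eq_norm] using hy)
    rw [delta2, h₁, h₂, hex]
    simp only [add_zero, mul_zero, sub_zero, abs_zero]
    positivity
  · have h₁ : |delta2 n e x y| ≤ 2 * C := by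
      rw [delta2, hex, mul_zero, sub_zero]
      exact (abs_add_le _ _).trans (by linarith [hC (x + y), hC (x - y)])
    have h₂ : 1 ≤ max 1 (ρ ^ 2)⁻¹ * min 1 (‖y‖ ^ 2) := by
      rcases le_total 1 (‖y‖ ^ 2) with h | h
      · rw [min_eq_left h, mul_one]; exact le_max_left _ _
      · rw [min_eq_right h]
        calc (1 : ℝ) = (ρ ^ 2)⁻¹ * ρ ^ 2 := by field_simp
          _ ≤ max 1 (ρ ^ 2)⁻¹ * ‖y‖ ^ 2 := by
            gcongr
            exact le_max_right _ _
    calc |delta2 n e x y| ≤ 2 * C * 1 := by linarith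
      _ ≤ 2 * C * (max 1 (ρ ^ 2)⁻¹ * min 1 (‖y‖ ^ 2)) := by gcongr
      _ = _ := by ring

/-- A lower bound for `M⁺` passes to the limit along perturbations that are measurable, uniformly
bounded, supported away from the base point and pointwise eventually zero. Nothing is required of
the limit function itself, since non-integrability is shared by the whole sequence. -/
lemma le_Mplus_of_approx (n : ℕ) {lam Lam : ℝ} (hlam : 0 < lam) (hLam : 0 < Lam)
    {ν : Eucl n → ℝ → ℝ} {x : Eucl n} (hmeas : Measurable (ν x)) (hν : ∀ r, 0 < r → 0 ≤ ν x r)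
    (hint : Integrable fun y : Eucl n => min 1 (‖y‖ ^ 2) * ν x ‖y‖)
    {v : Eucl n → ℝ} {V : ℕ → Eucl n → ℝ} (hVm : ∀ k, Measurable fun z => V k z - v z)
    {C ρ : ℝ} (hC : ∀ k z, |V k z - v z| ≤ C) (hρ : 0 < ρ)
    (hVρ : ∀ k, ∀ z ∈ ball x ρ, V k z - v z = 0) (hV : ∀ z, ∀ᶠ k in Filter.atTop, V k z = v z)
    {a : ℝ} (ha : ∀ k, a ≤ Mplus n lam Lam ν (V k) x) : a ≤ Mplus n lam Lam ν v x := by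
  have hsub : ∀ k y, delta2 n (V k) x y * ν x ‖y‖ = delta2 n v x y * ν x ‖y‖ +
      delta2 n (fun z => V k z - v z) x y * ν x ‖y‖ := fun k y => by
    simp only [delta2]; ring
  set D : ℝ := 2 * C * max 1 (ρ ^ 2)⁻¹
  have hbound : ∀ k y, |delta2 n (fun z => V k z - v z) x y * ν x ‖y‖| ≤
      D * |min 1 (‖y‖ ^ 2) * ν x ‖y‖| := fun k y =>
    abs_delta2_mul_le n (hC k) hρ (hVρ k) _ y
  have hdiff : ∀ k, Integrable fun y : Eucl n =>
      delta2 n (fun z => V k z - v z) x y * ν x ‖y‖ := fun k => by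
    refine Integrable.mono' (hint.abs.const_mul D) ?_ (Filter.Eventually.of_forall (hbound k))
    refine Measurable.aestronglyMeasurable ?_
    unfold delta2
    have h₁ : Measurable fun y : Eucl n => V k (x + y) - v (x + y) :=
      (hVm k).comp (measurable_const_add x)
    have h₂ : Measurable fun y : Eucl n => V k (x - y) - v (x - y) :=
      (hVm k).comp (measurable_const_sub x)
    exact ((h₁.add h₂).sub measurable_const).mul (hmeas.comp measurable_norm)
  have hM := fun v => Mplus_eq_integral_pucci n lam Lam ν v x hν
  simp only [hM] at ha ⊢
  by_cases hi : Integrable fun y : Eucl n => delta2 n v x y * ν x ‖y‖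
  · have hVi : ∀ k, Integrable fun y : Eucl n => delta2 n (V k) x y * ν x ‖y‖ := fun k => by
      simp only [hsub]; exact hi.add (hdiff k)
    refine ge_of_tendsto' (tendsto_integral_of_dominated_convergence
      (fun y => (|Lam| + |lam|) * (|delta2 n v x y * ν x ‖y‖| +
        D * |min 1 (‖y‖ ^ 2) * ν x ‖y‖|))
      (fun k => (integrable_pucci _ _ (hVi k)).aestronglyMeasurable)
      ((hi.abs.add (hint.abs.const_mul D)).const_mul _) (fun k => ?_) ?_) ha
    · refine Filter.Eventually.of_forall fun y => (abs_pucci_le _ _ _).trans ?_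
      refine mul_le_mul_of_nonneg_left ?_ (by positivity)
      rw [hsub]
      exact (abs_add_le _ _).trans (by linarith [hbound k y])
    · refine Filter.Eventually.of_forall fun y => tendsto_const_nhds.congr' ?_
      filter_upwards [hV (x + y), hV (x - y), hV x] with k h₁ h₂ h₃
      simp only [delta2, h₁, h₂, h₃]
  · have hVi : ¬ Integrable fun y : Eucl n => delta2 n (V 0) x y * ν x ‖y‖ := fun h => hi <| by
      refine (h.sub (hdiff 0)).congr (Filter.Eventually.of_forall fun y => ?_)
      simp [hsub]
    have h0 := ha 0
    rw [integral_undef (mt (integrable_pucci_iff hLam hlam).1 hVi)] at h0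
    rwa [integral_undef (mt (integrable_pucci_iff hLam hlam).1 hi)]

lemma LipschitzOnWith.congr_eqOn {α β : Type*} [PseudoEMetricSpace α] [PseudoEMetricSpace β]
    {L : NNReal} {f g : α → β} {s : Set α} (hf : LipschitzOnWith L f s) (h : EqOn f g s) :
    LipschitzOnWith L g s := fun a ha b hb => by
  rw [← h ha, ← h hb]; exact hf ha hb

section Cutoff

variable {E : Type*} [NormedAddCommGroup E] [NormedSpace ℝ E]

/-- Interpolating a `C^{1,1}` function on an open set `N` with a constant by means of a smooth
cutoff supported in `N` yields a globally defined function, locally of class `C^{1,1}`, whose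
gradient vanishes off `N`. -/
lemma cutoff_regular {N K : Set E} (hN : IsOpen N) (hK : IsClosed K) (hKN : K ⊆ N) {φ χ : E → ℝ}
    (hφ : DifferentiableOn ℝ φ N) {L : NNReal} (hL : LipschitzOnWith L (fderiv ℝ φ) N)
    (hχ : ContDiff ℝ 2 χ) (hχK : ∀ y ∉ K, χ y = 0) (c : ℝ) :
    Differentiable ℝ (fun y => c + χ y * (φ y - c)) ∧
      LocallyLipschitz (fderiv ℝ fun y => c + χ y * (φ y - c)) ∧
      ∀ y ∉ N, fderiv ℝ (fun y => c + χ y * (φ y - c)) y = 0 := by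
  set ψ : E → ℝ := fun y => c + χ y * (φ y - c)
  have hφat : ∀ y ∈ N, DifferentiableAt ℝ φ y := fun y hy =>
    (hφ y hy).differentiableAt (hN.mem_nhds hy)
  have hχd : Differentiable ℝ χ := hχ.differentiable (by norm_num)
  have hoff : ∀ y ∉ K, ψ =ᶠ[nhds y] fun _ => c := fun y hy => by
    filter_upwards [hK.isOpen_compl.mem_nhds hy] with z hz
    simp [ψ, hχK z hz]
  have hin : ∀ y ∈ N, HasFDerivAt ψ (χ y • fderiv ℝ φ y + (φ y - c) • fderiv ℝ χ y) y :=
    fun y hy => ((hχd y).hasFDerivAt.mul ((hφat y hy).hasFDerivAt.sub_const c)).const_add c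
  have hzero : ∀ y ∉ K, fderiv ℝ ψ y = 0 := fun y hy => by
    rw [(hoff y hy).fderiv_eq]; simp
  refine ⟨fun y => ?_, fun y => ?_, fun y hy => hzero y fun h => hy (hKN h)⟩
  · by_cases hy : y ∈ N
    · exact (hin y hy).differentiableAt
    · exact (hoff y fun h => hy (hKN h)).differentiableAt_iff.2 (differentiableAt_const c)
  by_cases hy : y ∈ N
  swap
  · refine ⟨0, Kᶜ, hK.isOpen_compl.mem_nhds fun h => hy (hKN h), fun a ha b hb => ?_⟩
    simp [hzero a ha, hzero b hb]
  have hNy := hN.mem_nhds hy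
  obtain ⟨L₁, t₁, ht₁, hL₁⟩ :=
    (hχ.of_le (by norm_num : (1 : WithTop ℕ∞) ≤ 2)).contDiffAt (x := y) |>.exists_lipschitzOnWith
  obtain ⟨L₂, t₂, ht₂, hL₂⟩ :=
    (hχ.fderiv_right (m := 1) (by norm_num)).contDiffAt (x := y) |>.exists_lipschitzOnWith
  obtain ⟨L₃, t₃, ht₃, hL₃⟩ :=
    (hasStrictFDerivAt_of_hasFDerivAt_of_continuousAt
      (Filter.eventually_of_mem hNy fun z hz => (hφat z hz).hasFDerivAt)
      (hL.continuousOn.continuousAt hNy)).exists_lipschitzOnWith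
  let P : E → (ℝ × (E →L[ℝ] ℝ)) × (ℝ × (E →L[ℝ] ℝ)) :=
    fun z => ((χ z, fderiv ℝ φ z), (φ z, fderiv ℝ χ z))
  let Φ : (ℝ × (E →L[ℝ] ℝ)) × (ℝ × (E →L[ℝ] ℝ)) → (E →L[ℝ] ℝ) :=
    fun p => p.1.1 • p.1.2 + (p.2.1 - c) • p.2.2
  have hΦ : ContDiff ℝ 1 Φ := by fun_prop
  obtain ⟨L₄, t₄, ht₄, hL₄⟩ := hΦ.contDiffAt (x := P y) |>.exists_lipschitzOnWith
  have hPL := ((hL₁.mono fun z (hz : z ∈ N ∩ (t₁ ∩ (t₂ ∩ t₃))) => hz.2.1).prodMk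
    (hL.mono fun z hz => hz.1)).prodMk ((hL₃.mono fun z hz => hz.2.2.2).prodMk
    (hL₂.mono fun z hz => hz.2.2.1))
  have hT : N ∩ (t₁ ∩ (t₂ ∩ t₃)) ∈ nhds y :=
    Filter.inter_mem hNy (Filter.inter_mem ht₁ (Filter.inter_mem ht₂ ht₃))
  have hPc : ContinuousAt P y := hPL.continuousOn.continuousAt hT
  refine ⟨_, _, Filter.inter_mem hT (hPc.preimage_mem_nhds ht₄), LipschitzOnWith.congr_eqOn
    (f := Φ ∘ P) (hL₄.comp (hPL.mono inter_subset_left) fun z hz => hz.2) fun z hz => ?_⟩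
  exact (hin z hz.1.1).fderiv.symm

/-- Smooth cutoffs supported in an open set `N` and increasing to its indicator. -/
lemma exists_cutoff_seq [FiniteDimensional ℝ E] {N : Set E} (hN : IsOpen N) :
    ∃ (χ : ℕ → E → ℝ) (K : ℕ → Set E), (∀ k, ContDiff ℝ 2 (χ k)) ∧ (∀ k, IsClosed (K k)) ∧
      (∀ k, K k ⊆ N) ∧ (∀ k, ∀ y ∉ K k, χ k y = 0) ∧ (∀ k y, χ k y ∈ Icc (0 : ℝ) 1) ∧
      ∀ y ∈ N, ∃ k₀ : ℕ, ∀ᶠ z in nhds y, ∀ k ≥ k₀, χ k z = 1 := by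
  obtain ⟨g, hg, hgd, hg01⟩ := hN.exists_contDiff_support_eq (n := 2)
  have hgd : ContDiff ℝ 2 g := hgd
  refine ⟨fun k y => Real.smoothTransition (k * g y - 1), fun k => {y | 1 ≤ k * g y}, fun k => ?_,
    fun k => isClosed_le continuous_const (continuous_const.mul hgd.continuous),
    fun k y hy => ?_, fun k y hy => ?_, fun k y => ⟨Real.smoothTransition.nonneg _,
    Real.smoothTransition.le_one _⟩, fun y hy => ?_⟩
  · exact (Real.smoothTransition.contDiff (n := 2)).comp
      ((contDiff_const.mul hgd).sub contDiff_const)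
  · rw [← hg, Function.mem_support]
    intro h
    simp only [mem_ofPred_eq, h, mul_zero] at hy
    linarith
  · simp only [mem_ofPred_eq, not_le] at hy
    exact Real.smoothTransition.zero_of_nonpos (by linarith)
  · have hgy : 0 < g y := lt_of_le_of_ne (hg01 (mem_range_self y)).1
      (Ne.symm (by rw [← hg] at hy; exact hy))
    obtain ⟨k₀, hk₀⟩ := exists_nat_gt (2 / g y)
    refine ⟨k₀, ?_⟩
    have h2 : 2 < k₀ * g y := by rwa [div_lt_iff₀ hgy] at hk₀
    have hc : Continuous fun z => (k₀ : ℝ) * g z := continuous_const.mul hgd.continuous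
    filter_upwards [hc.continuousAt.eventually (lt_mem_nhds h2)] with z hz k hk
    have hgz : 0 ≤ g z := (hg01 (mem_range_self z)).1
    have : (k₀ : ℝ) * g z ≤ k * g z := by gcongr
    exact Real.smoothTransition.one_of_one_le (by linarith)

end Cutoff

lemma C11On_closure_of_regular (n : ℕ) {N : Set (Eucl n)} (hN : IsOpen N)
    (hb : Bornology.IsBounded N) {ψ : Eucl n → ℝ} (hd : Differentiable ℝ ψ)
    (hl : LocallyLipschitz (fderiv ℝ ψ)) (h0 : ∀ y ∉ N, fderiv ℝ ψ y = 0) :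
    C11On n ψ (closure N) := by
  refine ⟨hd.differentiableOn, ?_⟩
  obtain ⟨L, hL⟩ := (hl.locallyLipschitzOn (s := closure N)).exists_lipschitzOnWith_of_compact
    hb.isCompact_closure
  refine ⟨L, hL.congr_eqOn fun y _ => ?_⟩
  by_cases hy : y ∈ N
  · exact (fderivWithin_of_mem_nhds
      (Filter.mem_of_superset (hN.mem_nhds hy) subset_closure)).symm
  · have h := (hd y).hasFDerivAt
    rw [h0 y hy] at h
    rw [h0 y hy, fderivWithin, if_pos h.hasFDerivWithinAt]

lemma regular_comp_affine (n : ℕ) {ψ : Eucl n → ℝ} (hd : Differentiable ℝ ψ)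
    (hl : LocallyLipschitz (fderiv ℝ ψ)) (c : ℝ) (x₀ : Eucl n) :
    Differentiable ℝ (fun z => ψ (c • (z - x₀))) ∧
      LocallyLipschitz (fderiv ℝ fun z => ψ (c • (z - x₀))) ∧
      ∀ z, fderiv ℝ ψ (c • (z - x₀)) = 0 → fderiv ℝ (fun z => ψ (c • (z - x₀))) z = 0 := by
  have hf : ∀ z, fderiv ℝ (fun z => ψ (c • (z - x₀))) z = c • fderiv ℝ ψ (c • (z - x₀)) :=
    fun z => by rw [fderiv_comp_sub (f := fun w => ψ (c • w)), fderiv_comp_smul]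
  refine ⟨by fun_prop, ?_, fun z hz => by rw [hf, hz, smul_zero]⟩
  have hS : LocallyLipschitz fun z : Eucl n => c • (z - x₀) :=
    ContDiff.locallyLipschitz (𝕂 := ℝ) (by fun_prop)
  have hc : LocallyLipschitz fun A : Eucl n →L[ℝ] ℝ => c • A :=
    ContDiff.locallyLipschitz (𝕂 := ℝ) (by fun_prop)
  rw [funext hf]
  exact hc.comp (hl.comp hS)

section Rescaling

variable {n : ℕ} {ν : Eucl n → ℝ → ℝ} {R : ℝ} (x₀ : Eucl n)

lemma hfun_rescale (hR : 0 < R) (x : Eucl n) {s : ℝ} (hs : 0 < s) :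
    hfun n (fun x r => R ^ n * ν (R • x + x₀) (R * r) / hfun n ν (R • x + x₀) R) x s =
      hfun n ν (R • x + x₀) (R * s) / hfun n ν (R • x + x₀) R := by
  set H := hfun n ν (R • x + x₀) R
  let g : Eucl n → ℝ := fun z => min 1 (‖z‖ ^ 2 / (R * s) ^ 2) * ν (R • x + x₀) ‖z‖
  have h := Measure.integral_comp_smul volume g R
  rw [finrank_euclideanSpace, Fintype.card_fin, abs_of_pos (by positivity), smul_eq_mul] at h
  have hg : ∀ y : Eucl n, min 1 (‖y‖ ^ 2 / s ^ 2) *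
      (R ^ n * ν (R • x + x₀) (R * ‖y‖) / H) = R ^ n / H * g (R • y) := fun y => by
    simp only [g, norm_smul, Real.norm_eq_abs, abs_of_pos hR]
    rw [show (R * ‖y‖) ^ 2 / (R * s) ^ 2 = ‖y‖ ^ 2 / s ^ 2 by field_simp]
    ring
  change ∫ y : Eucl n, min 1 (‖y‖ ^ 2 / s ^ 2) * (R ^ n * ν (R • x + x₀) (R * ‖y‖) / H) =
    (∫ z, g z) / H
  simp only [hg]
  rw [integral_const_mul, h]
  field_simp

lemma Mplus_rescale (lam Lam : ℝ) (hR : 0 < R) (x : Eucl n) {v w : Eucl n → ℝ}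
    (hvw : ∀ y, w (R • y + x₀) = v y) :
    Mplus n lam Lam (fun x r => R ^ n * ν (R • x + x₀) (R * r) / hfun n ν (R • x + x₀) R) v x =
      Mplus n lam Lam ν w (R • x + x₀) / hfun n ν (R • x + x₀) R := by
  set H := hfun n ν (R • x + x₀) R
  let g : Eucl n → ℝ := fun z => (Lam * max (delta2 n w (R • x + x₀) z) 0 -
    lam * max (-delta2 n w (R • x + x₀) z) 0) * ν (R • x + x₀) ‖z‖
  have h := Measure.integral_comp_smul volume g R
  rw [finrank_euclideanSpace, Fintype.card_fin, abs_of_pos (by positivity), smul_eq_mul] at h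
  have hδ : ∀ y, delta2 n w (R • x + x₀) (R • y) = delta2 n v x y := fun y => by
    simp only [delta2, ← hvw]
    rw [show R • (x + y) + x₀ = R • x + x₀ + R • y by module,
      show R • (x - y) + x₀ = R • x + x₀ - R • y by module]
  have hg : ∀ y : Eucl n, (Lam * max (delta2 n v x y) 0 - lam * max (-delta2 n v x y) 0) *
      (R ^ n * ν (R • x + x₀) (R * ‖y‖) / H) = R ^ n / H * g (R • y) := fun y => by
    simp only [g, hδ, norm_smul, Real.norm_eq_abs, abs_of_pos hR]
    ring
  change ∫ y : Eucl n, (Lam * max (delta2 n v x y) 0 - lam * max (-delta2 n v x y) 0) *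
      (R ^ n * ν (R • x + x₀) (R * ‖y‖) / H) = (∫ z, g z) / H
  simp only [hg]
  rw [integral_const_mul, h]
  field_simp

end Rescaling

/-- The rescaled function satisfies the viscosity inequality for test functions whose gradient
vanishes off the test neighborhood. -/
lemma subsol_rescale_of_regular {n : ℕ} {lam Lam : ℝ} {ν : Eucl n → ℝ → ℝ} {R : ℝ} (hR : 0 < R)
    (x₀ : Eucl n) (hpos : ∀ x, 0 < hfun n ν x R) {u f : Eucl n → ℝ}
    (hu : IsViscositySubsol n lam Lam ν u f (ball x₀ R)) {x : Eucl n} {N : Set (Eucl n)}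
    (hN : IsOpen N) (hxN : x ∈ N) (hNB : N ⊆ ball 0 1) {ψ : Eucl n → ℝ}
    (hd : Differentiable ℝ ψ) (hl : LocallyLipschitz (fderiv ℝ ψ))
    (h0 : ∀ y ∉ N, fderiv ℝ ψ y = 0) (hψx : ψ x = u (R • x + x₀))
    (hψ : ∀ y ∈ N, u (R • y + x₀) ≤ ψ y) :
    f (R • x + x₀) / hfun n ν (R • x + x₀) R ≤ Mplus n lam Lam
      (fun x r => R ^ n * ν (R • x + x₀) (R * r) / hfun n ν (R • x + x₀) R)
      (replaceOn n (fun x => u (R • x + x₀)) ψ N) x := by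
  let S : Eucl n → Eucl n := fun z => R⁻¹ • (z - x₀)
  have hST : ∀ y, S (R • y + x₀) = y := fun y => by simp [S, smul_smul, hR.ne']
  have hTS : ∀ z, R • S z + x₀ = z := fun z => by simp [S, smul_smul, hR.ne']
  have hSc : Continuous S := by fun_prop
  have hsub : S ⁻¹' N ⊆ ball x₀ R := fun z hz => by
    have h := hNB hz
    rw [mem_ball_zero_iff, norm_smul, norm_inv, Real.norm_eq_abs, abs_of_pos hR,
      inv_mul_lt_iff₀ hR, mul_one] at h
    rwa [mem_ball, dist_eq_norm]
  obtain ⟨hd', hl', h0'⟩ := regular_comp_affine n hd hl R⁻¹ x₀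
  have hx' : R • x + x₀ ∈ S ⁻¹' N := by rwa [mem_preimage, hST]
  rw [Mplus_rescale x₀ lam Lam hR x (w := replaceOn n u (fun z => ψ (S z)) (S ⁻¹' N))
    fun y => by
      have : R • y + x₀ ∈ S ⁻¹' N ↔ y ∈ N := by rw [mem_preimage, hST]
      by_cases hy : y ∈ N
      · simp only [replaceOn, if_pos hy, if_pos (this.2 hy), hST]
      · simp only [replaceOn, if_neg hy, if_neg (mt this.1 hy)]]
  refine div_le_div_of_nonneg_right (hu _ (hsub hx') _ (hN.preimage hSc) hx' hsub _ ?_ ?_ ?_)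
    (hpos _).le
  · exact C11On_closure_of_regular n (hN.preimage hSc) (isBounded_ball.subset hsub) hd' hl'
      fun z hz => h0' z (h0 _ hz)
  · simp only [hST, hψx]
  · intro z hz
    simpa only [hTS] using hψ (S z) hz

lemma subsol_rescale {n : ℕ} {lam Lam : ℝ} (hlam : 0 < lam) (hLam : 0 < Lam)
    {ν : Eucl n → ℝ → ℝ} (hK : KernelOK n ν) {R : ℝ} (hR : 0 < R) (x₀ : Eucl n)
    (hpos : ∀ x, 0 < hfun n ν x R) {u f : Eucl n → ℝ}
    (hu : IsViscositySubsol n lam Lam ν u f (ball x₀ R)) :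
    IsViscositySubsol n lam Lam
      (fun x r => R ^ n * ν (R • x + x₀) (R * r) / hfun n ν (R • x + x₀) R)
      (fun x => u (R • x + x₀)) (fun x => f (R • x + x₀) / hfun n ν (R • x + x₀) R)
      (ball (0 : Eucl n) 1) := by
  rintro x - N hN hxN hNB φ ⟨hφd, L, hφL⟩ hφx hφ
  have hφN : DifferentiableOn ℝ φ N := hφd.mono subset_closure
  have hLN : LipschitzOnWith L (fderiv ℝ φ) N := (hφL.mono subset_closure).congr_eqOn fun y hy =>
    fderivWithin_of_mem_nhds (Filter.mem_of_superset (hN.mem_nhds hy) subset_closure)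
  obtain ⟨M, hM⟩ := (isBounded_ball.subset hNB).isCompact_closure.exists_bound_of_continuousOn
    hφd.continuousOn
  have hM : ∀ y ∈ N, |φ y| ≤ M := fun y hy => hM y (subset_closure hy)
  have hM0 : 0 ≤ M := (abs_nonneg _).trans (hM x hxN)
  obtain ⟨χ, K, hχd, hKc, hKN, hχK, hχ01, hχ1⟩ := exists_cutoff_seq hN
  let ψ : ℕ → Eucl n → ℝ := fun k y => M + χ k y * (φ y - M)
  have hreg := fun k => cutoff_regular hN (hKc k) (hKN k) hφN hLN (hχd k) (hχK k) M
  have hψφ : ∀ k, ∀ y ∈ N, φ y ≤ ψ k y ∧ |ψ k y - φ y| ≤ 2 * M := fun k y hy => by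
    obtain ⟨h0, h1⟩ := hχ01 k y
    obtain ⟨hl, hr⟩ := abs_le.1 (hM y hy)
    have he : ψ k y - φ y = (1 - χ k y) * (M - φ y) := by simp only [ψ]; ring
    have he0 : 0 ≤ ψ k y - φ y := by
      rw [he]; exact mul_nonneg (by linarith) (by linarith)
    refine ⟨by linarith, ?_⟩
    rw [abs_of_nonneg he0, he]
    nlinarith
  have hψ1 : ∀ k y, χ k y = 1 → ψ k y = φ y := fun k y h => by simp only [ψ, h]; ring
  obtain ⟨k₀, hk₀⟩ := hχ1 x hxN
  obtain ⟨ρ, hρ, hρχ⟩ := Metric.eventually_nhds_iff_ball.1 hk₀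
  let ut : Eucl n → ℝ := fun x => u (R • x + x₀)
  have hdiff : ∀ k z, replaceOn n ut (ψ (k + k₀)) N z - replaceOn n ut φ N z =
      N.indicator (fun y => ψ (k + k₀) y - φ y) z := fun k z => by
    by_cases hz : z ∈ N <;> simp [replaceOn, hz]
  refine le_Mplus_of_approx n hlam hLam (V := fun k => replaceOn n ut (ψ (k + k₀)) N)
    (C := 2 * M) (ρ := ρ) ?_ ?_ ?_ ?_ ?_ hρ ?_ ?_ ?_
  · exact ((((hK.1.of_uncurry_left (x := R • x + x₀)).comp (measurable_const_mul R)).const_mul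
      _).div_const _)
  · intro r hr
    exact div_nonneg (mul_nonneg (by positivity) (hK.2.1 _ _ (by positivity))) (hpos _).le
  · by_contra h
    have h1 := hfun_rescale (ν := ν) x₀ hR x one_pos
    rw [mul_one, div_self (hpos _).ne', hfun] at h1
    simp only [one_pow, div_one] at h1
    rw [integral_undef h] at h1
    exact zero_ne_one h1
  · intro k
    rw [funext (hdiff k)]
    have hc : ContinuousOn (fun y => ψ (k + k₀) y - φ y) N :=
      (hreg _).1.continuous.continuousOn.sub hφN.continuousOn
    classical
    rw [← piecewise_eq_indicator]
    exact hc.measurable_piecewise (g := 0) continuousOn_const hN.measurableSet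
  · intro k z
    rw [hdiff]
    by_cases hz : z ∈ N
    · rw [indicator_of_mem hz]; exact (hψφ _ z hz).2
    · rw [indicator_of_notMem hz, abs_zero]; positivity
  · intro k z hz
    rw [hdiff]
    by_cases hzN : z ∈ N
    · rw [indicator_of_mem hzN, hψ1 _ _ (hρχ z hz _ (by omega)), sub_self]
    · exact indicator_of_notMem hzN _
  · intro z
    by_cases hz : z ∈ N
    · obtain ⟨k₁, hk₁⟩ := hχ1 z hz
      filter_upwards [Filter.eventually_ge_atTop k₁] with k hk
      simp only [replaceOn, if_pos hz]
      exact hψ1 _ _ (hk₁.self_of_nhds _ (by omega))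
    · exact Filter.Eventually.of_forall fun k => by simp [replaceOn, hz, ut]
  · intro k
    obtain ⟨hd, hl, h0⟩ := hreg (k + k₀)
    refine subsol_rescale_of_regular hR x₀ hpos hu hN hxN hNB hd hl h0 ?_ ?_
    · exact (hψ1 _ _ (hρχ x (mem_ball_self hρ) _ (by omega))).trans hφx
    · exact fun y hy => (hφ y hy).trans (hψφ _ y hy).1

/-- **Proposition 2.4** (translation and scale invariance). -/
theorem scaling_invariance (n : ℕ) (hn : 1 ≤ n) (lam Lam : ℝ)
    (hlam : 0 < lam) (hlamLam : lam ≤ Lam)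
    (ν : Eucl n → ℝ → ℝ) (hK : KernelOK n ν)
    (R : ℝ) (hR : 0 < R) (x₀ : Eucl n)
    (hpos : ∀ x : Eucl n, 0 < hfun n ν x R)
    (ν' : Eucl n → ℝ → ℝ)
    (hν' : ν' = fun x r => R ^ n * ν (R • x + x₀) (R * r) / hfun n ν (R • x + x₀) R) :
    (∀ u f : Eucl n → ℝ,
      IsViscositySubsol n lam Lam ν u f (Metric.ball x₀ R) →
      IsViscositySubsol n lam Lam ν' (fun x => u (R • x + x₀))
        (fun x => f (R • x + x₀) / hfun n ν (R • x + x₀) R) (Metric.ball (0 : Eucl n) 1)) ∧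
    (∀ (x : Eucl n) (s : ℝ), 0 < s →
      hfun n ν' x s = hfun n ν (R • x + x₀) (R * s) / hfun n ν (R • x + x₀) R) ∧
    CondA1 n ν' ∧
    (CondA2 n ν → CondA2 n ν') ∧
    (∀ cU α : ℝ, 0 < cU → 0 < α → CondA3 n ν cU α → CondA3 n ν' cU α) ∧
    (∀ cs : ℝ, 1 ≤ cs → CondB n ν cs → CondB n ν' cs) := by
  have hh : ∀ (x : Eucl n) (s : ℝ), 0 < s →
      hfun n ν' x s = hfun n ν (R • x + x₀) (R * s) / hfun n ν (R • x + x₀) R := by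
    subst hν'
    exact fun x s hs => hfun_rescale x₀ hR x hs
  refine ⟨fun u f hu => ?_, hh, fun x => ?_, fun hA x s r hs hsr => ?_, fun cU α _ _ hA x r t hr ht
    => ?_, fun cs _ hB x₁ x₂ s r hs hx hsr => ?_⟩
  · subst hν'
    exact subsol_rescale hlam (hlam.trans_le hlamLam) hK hR x₀ hpos hu
  · rw [hh x 1 one_pos, mul_one, div_self (hpos _).ne']
  · rw [hν']
    have := hA (R • x + x₀) (R * s) (R * r) (by positivity) (by gcongr)
    have := (hpos (R • x + x₀)).le
    dsimp only
    gcongr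
  · rw [hh x _ (by positivity), hh x r hr, ← mul_div_assoc]
    have := hA (R • x + x₀) (R * r) t (by positivity) ht
    rw [show R * (t * r) = t * (R * r) by ring]
    exact div_le_div_of_nonneg_right this (hpos _).le
  · have hd : dist (R • x₁ + x₀) (R • x₂ + x₀) ≤ R * s := by
      rw [dist_add_right, dist_smul₀, Real.norm_eq_abs, abs_of_pos hR]
      gcongr
    have hB' := hB _ _ (R * s) (R * r) (by positivity) hd (by gcongr)
    rw [hh _ s hs, hh _ s hs, hν']
    dsimp only
    have h₁ := hpos (R • x₁ + x₀)
    have h₂ := hpos (R • x₂ + x₀)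
    calc _ = R ^ n / (hfun n ν (R • x₁ + x₀) R * hfun n ν (R • x₂ + x₀) R) *
          (ν (R • x₁ + x₀) (R * r) * hfun n ν (R • x₂ + x₀) (R * s)) := by field_simp
      _ ≤ R ^ n / (hfun n ν (R • x₁ + x₀) R * hfun n ν (R • x₂ + x₀) R) *
          (cs * (ν (R • x₂ + x₀) (R * r) * hfun n ν (R • x₁ + x₀) (R * s))) := by gcongr
      _ = _ := by field_simp
end
end

section
/- There exists a constant p > 0 depending only on n, λ, Λ, c_U and α with the following property: for every ν satisfying condition (A) and every s₁ > 0, the function f(x) := min( (s₁/2)^{−p}, |x|^{−p} ) satisfies M⁻_ν f(x) ≥ 0 for every x ∈ ℝⁿ with |x| > s₁; here the integral defining M⁻_ν f(x) converges absolutely. -/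
open MeasureTheory Metric Set
open scoped ENNReal

noncomputable section

open scoped InnerProductSpace

section Cone

variable {E : Type*} [NormedAddCommGroup E] [InnerProductSpace ℝ E] [FiniteDimensional ℝ E]
  [MeasurableSpace E] [BorelSpace E]

/-- The open cone of vectors whose angle with the unit vector `e` has cosine larger than `3/4`. -/
def openCone (e : E) : Set E := {y | 3 / 4 * ‖y‖ < ⟪e, y⟫_ℝ}

theorem measurableSet_openCone (e : E) : MeasurableSet (openCone e) :=
  measurableSet_lt (by fun_prop) (by fun_prop)

/-- The integral of a radial function over `openCone e` does not depend on the unit vector `e`. -/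
theorem integral_indicator_openCone_eq (G : ℝ → ℝ) {e e' : E} (h : ‖e‖ = ‖e'‖) :
    ∫ y : E, (openCone e).indicator (fun z => G ‖z‖) y =
      ∫ y : E, (openCone e').indicator (fun z => G ‖z‖) y := by
  set T : E ≃ₗᵢ[ℝ] E := (ℝ ∙ (e - e'))ᗮ.reflection with hT
  have hTe : T e = e' := Submodule.reflection_sub h
  have hcomp := T.measurePreserving.integral_comp T.toHomeomorph.measurableEmbedding
    (fun y => (openCone e').indicator (fun z => G ‖z‖) y)
  rw [← hcomp]
  congr 1
  ext y
  have hmem : T y ∈ openCone e' ↔ y ∈ openCone e := by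
    simp only [openCone, mem_ofPred_eq, T.norm_map]
    rw [← T.inner_map_map e y, hTe]
  by_cases hy : y ∈ openCone e
  · rw [indicator_of_mem hy, indicator_of_mem (hmem.2 hy), T.norm_map]
  · rw [indicator_of_notMem hy, indicator_of_notMem (fun h => hy (hmem.1 h))]

variable (E) in
/-- A fixed cone carries a definite fraction of the integral of every nonnegative radial
function. -/
theorem exists_integral_le_mul_integral_openCone [Nontrivial E] :
    ∃ N : ℕ, ∀ G : ℝ → ℝ, (∀ r, 0 < r → 0 ≤ G r) → Integrable (fun y : E => G ‖y‖) →
      ∀ e : E, ‖e‖ = 1 →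
        ∫ y : E, G ‖y‖ ≤ N * ∫ y : E, (openCone e).indicator (fun z => G ‖z‖) y := by
  obtain ⟨t, ht, hcover⟩ := (isCompact_sphere (0 : E) 1).elim_nhds_subcover
    (fun e => {y : E | 3 / 4 < ⟪e, y⟫_ℝ}) (fun e he => by
      refine (isOpen_lt continuous_const (by fun_prop)).mem_nhds ?_
      have : ‖e‖ = 1 := by simpa using he
      simp only [mem_ofPred_eq, real_inner_self_eq_norm_sq, this]
      norm_num)
  refine ⟨t.card, fun G hG hint e he => ?_⟩
  have hsum : ∫ y : E, G ‖y‖ ≤ ∫ y : E, ∑ i ∈ t, (openCone i).indicator (fun z => G ‖z‖) y := by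
    refine integral_mono_ae hint
      (integrable_finsetSum _ fun i _ => hint.indicator (measurableSet_openCone i)) ?_
    have hne : ∀ᵐ y : E, y ≠ 0 := by simp [ae_iff]
    filter_upwards [hne] with y hy
    have hy0 : 0 < ‖y‖ := norm_pos_iff.2 hy
    have hmem : ‖y‖⁻¹ • y ∈ sphere (0 : E) 1 := by
      simp [norm_smul, hy0.ne']
    obtain ⟨i, hi, hyi⟩ := mem_iUnion₂.1 (hcover hmem)
    have hyi' : y ∈ openCone i := by
      simp only [mem_ofPred_eq, inner_smul_right] at hyi
      rw [inv_mul_eq_div, lt_div_iff₀ hy0] at hyi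
      exact hyi
    calc G ‖y‖ = (openCone i).indicator (fun z => G ‖z‖) y := by rw [indicator_of_mem hyi']
      _ ≤ _ := Finset.single_le_sum
        (f := fun i => (openCone i).indicator (fun z => G ‖z‖) y)
        (fun j _ => indicator_apply_nonneg fun _ => hG _ hy0) hi
  rw [integral_finsetSum _ fun i _ => hint.indicator (measurableSet_openCone i)] at hsum
  refine hsum.trans_eq ?_
  rw [Finset.sum_congr rfl fun i hi => integral_indicator_openCone_eq G (e' := e)
    (by rw [he]; simpa using ht i hi)]
  simp

end Cone

section SecondDifference

theorem one_add_mul_le_one_sub_rpow_neg {t s : ℝ} (ht : t < 1) (hs : 0 ≤ s) :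
    1 + s * t ≤ (1 - t) ^ (-s) := by
  have h1 : 1 - t ≤ Real.exp (-t) := by linarith [Real.add_one_le_exp (-t)]
  calc 1 + s * t ≤ Real.exp (s * t) := by linarith [Real.add_one_le_exp (s * t)]
    _ = Real.exp (-t) ^ (-s) := by rw [← Real.exp_mul]; ring_nf
    _ ≤ (1 - t) ^ (-s) := Real.rpow_le_rpow_of_nonpos (by linarith) h1 (by linarith)

theorem exists_abs_rpow_neg_sub_le {m s : ℝ} (hm : 0 < m) (hs : 0 ≤ s) :
    ∃ L : ℝ, 0 ≤ L ∧ ∀ u v, m ≤ u → m ≤ v → |u ^ (-s) - v ^ (-s)| ≤ L * |u - v| := by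
  refine ⟨s * m ^ (-s - 1), by positivity, fun u v hu hv => ?_⟩
  have := (convex_Ici m).norm_image_sub_le_of_norm_hasDerivWithin_le
    (f := fun z : ℝ => z ^ (-s)) (f' := fun z => -s * z ^ (-s - 1)) (C := s * m ^ (-s - 1))
    (fun z hz => (Real.hasDerivAt_rpow_const (Or.inl (hm.trans_le hz).ne')).hasDerivWithinAt)
    (fun z hz => by
      have hz0 : 0 < z := hm.trans_le hz
      rw [Real.norm_eq_abs, abs_mul, abs_neg, abs_of_nonneg hs,
        abs_of_pos (Real.rpow_pos_of_pos hz0 _)]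
      exact mul_le_mul_of_nonneg_left
        (Real.rpow_le_rpow_of_nonpos hm hz (by linarith)) hs)
    (x := v) (y := u) hv hu
  simpa [Real.norm_eq_abs] using this

/-- Completing the square in a sum of two negative powers. -/
theorem rpow_neg_add_rpow_neg {a b : ℝ} (ha : 0 < a) (hb : 0 < b) (p : ℝ) :
    a ^ (-p) + b ^ (-p) =
      (a ^ (-(p / 2)) - b ^ (-(p / 2))) ^ 2 + 2 * (a * b) ^ (-(p / 2)) := by
  have h : ∀ c : ℝ, 0 < c → c ^ (-p) = (c ^ (-(p / 2))) ^ 2 := fun c hc => by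
    rw [← Real.rpow_natCast, ← Real.rpow_mul hc.le]
    congr 1
    push_cast
    ring
  rw [h a ha, h b hb, Real.mul_rpow ha.le hb.le]
  ring

theorem sq_rpow_neg_half {r : ℝ} (hr : 0 ≤ r) (p : ℝ) : (r ^ 2) ^ (-(p / 2)) = r ^ (-p) := by
  rw [← Real.rpow_natCast, ← Real.rpow_mul hr]
  congr 1
  push_cast
  ring

theorem half_norm_le_norm_add {E : Type*} [NormedAddCommGroup E] {x y : E} (h : ‖y‖ ≤ ‖x‖ / 2) : ‖x‖ / 2 ≤ ‖x + y‖ := by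
  have := norm_sub_le (x + y) y
  rw [add_sub_cancel_right] at this
  linarith

theorem half_norm_le_norm_sub {E : Type*} [NormedAddCommGroup E] {x y : E} (h : ‖y‖ ≤ ‖x‖ / 2) : ‖x‖ / 2 ≤ ‖x - y‖ := by
  rw [sub_eq_add_neg]
  exact half_norm_le_norm_add (by rwa [norm_neg])

variable {E : Type*} [NormedAddCommGroup E] [InnerProductSpace ℝ E]

theorem sq_norm_add_mul_norm_sub (x y : E) :
    (‖x + y‖ * ‖x - y‖) ^ 2 = (‖x‖ ^ 2 + ‖y‖ ^ 2) ^ 2 - 4 * ⟪x, y⟫_ℝ ^ 2 := by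
  rw [mul_pow, norm_add_sq_real, norm_sub_sq_real]
  ring

/-- Lower bound for the second difference of `‖·‖ ^ (-p)` in an arbitrary direction. -/
theorem neg_le_second_difference {x y : E} (hx : 0 < ‖x‖) (h : ‖y‖ ≤ ‖x‖ / 2) {p : ℝ}
    (hp : 0 < p) :
    -(‖x‖ ^ (-p) * (p * (‖y‖ ^ 2 / ‖x‖ ^ 2))) ≤
      ‖x + y‖ ^ (-p) + ‖x - y‖ ^ (-p) - 2 * ‖x‖ ^ (-p) := by
  have ha : 0 < ‖x + y‖ := by linarith [half_norm_le_norm_add h]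
  have hb : 0 < ‖x - y‖ := by linarith [half_norm_le_norm_sub h]
  have hab : ‖x + y‖ * ‖x - y‖ ≤ ‖x‖ ^ 2 + ‖y‖ ^ 2 := by
    refine le_of_sq_le_sq ?_ (by positivity)
    rw [sq_norm_add_mul_norm_sub]
    nlinarith [sq_nonneg ⟪x, y⟫_ℝ]
  have hfac : ‖x‖ ^ 2 + ‖y‖ ^ 2 = ‖x‖ ^ 2 * (1 - -(‖y‖ ^ 2 / ‖x‖ ^ 2)) := by
    field_simp
    ring
  have hq : 0 ≤ ‖y‖ ^ 2 / ‖x‖ ^ 2 := by positivity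
  have hmain : ‖x‖ ^ (-p) * (1 + p / 2 * -(‖y‖ ^ 2 / ‖x‖ ^ 2)) ≤
      (‖x + y‖ * ‖x - y‖) ^ (-(p / 2)) := by
    calc _ ≤ ‖x‖ ^ (-p) * (1 - -(‖y‖ ^ 2 / ‖x‖ ^ 2)) ^ (-(p / 2)) := by
          gcongr
          exact one_add_mul_le_one_sub_rpow_neg (by linarith) (by positivity)
      _ = (‖x‖ ^ 2 + ‖y‖ ^ 2) ^ (-(p / 2)) := by
          rw [hfac, Real.mul_rpow (by positivity) (by linarith), sq_rpow_neg_half hx.le]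
      _ ≤ _ := Real.rpow_le_rpow_of_nonpos (by positivity) hab (by linarith)
  rw [rpow_neg_add_rpow_neg ha hb]
  nlinarith [sq_nonneg (‖x + y‖ ^ (-(p / 2)) - ‖x - y‖ ^ (-(p / 2)))]

/-- Lower bound for the second difference of `‖·‖ ^ (-p)` in directions close to that of `x`. -/
theorem le_second_difference_of_inner {x y : E} (hx : 0 < ‖x‖) (h : ‖y‖ ≤ ‖x‖ / 2)
    (hxy : 3 / 4 * (‖x‖ * ‖y‖) ≤ ⟪x, y⟫_ℝ) {p : ℝ} (hp : 0 < p) :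
    ‖x‖ ^ (-p) * (p ^ 2 / 16 * (‖y‖ ^ 2 / ‖x‖ ^ 2)) ≤
      ‖x + y‖ ^ (-p) + ‖x - y‖ ^ (-p) - 2 * ‖x‖ ^ (-p) := by
  have ha : 0 < ‖x + y‖ := by linarith [half_norm_le_norm_add h]
  have hb : 0 < ‖x - y‖ := by linarith [half_norm_le_norm_sub h]
  have hy := norm_nonneg y
  have hxy0 : 0 ≤ ‖x‖ * ‖y‖ := by positivity
  have hyx : ‖y‖ ^ 2 ≤ ‖x‖ * ‖y‖ / 2 := by nlinarith
  have hyx2 : ‖y‖ ^ 2 ≤ ‖x‖ ^ 2 / 4 := by nlinarith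
  have hab : ‖x + y‖ * ‖x - y‖ ≤ ‖x‖ ^ 2 := by
    refine le_of_sq_le_sq ?_ (by positivity)
    rw [sq_norm_add_mul_norm_sub]
    have h1 : (3 / 4 * (‖x‖ * ‖y‖)) ^ 2 ≤ ⟪x, y⟫_ℝ ^ 2 :=
      pow_le_pow_left₀ (by positivity) hxy 2
    nlinarith [mul_le_mul_of_nonneg_left hyx2 (sq_nonneg ‖y‖)]
  have hA : ‖x‖ ≤ ‖x + y‖ := by
    refine le_of_sq_le_sq ?_ ha.le
    rw [norm_add_sq_real]
    nlinarith [sq_nonneg ‖y‖]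
  have ht : ‖y‖ / ‖x‖ ≤ 1 / 2 := by
    rw [div_le_iff₀ hx]; linarith
  have hB : ‖x - y‖ ^ 2 ≤ ‖x‖ ^ 2 * (1 - ‖y‖ / ‖x‖) := by
    have : ‖x‖ ^ 2 * (1 - ‖y‖ / ‖x‖) = ‖x‖ ^ 2 - ‖x‖ * ‖y‖ := by field_simp
    rw [this, norm_sub_sq_real]
    nlinarith
  have hA' : ‖x + y‖ ^ (-(p / 2)) ≤ ‖x‖ ^ (-(p / 2)) :=
    Real.rpow_le_rpow_of_nonpos hx hA (by linarith)
  have hB' : ‖x‖ ^ (-(p / 2)) * (1 + p / 2 / 2 * (‖y‖ / ‖x‖)) ≤ ‖x - y‖ ^ (-(p / 2)) := by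
    calc _ ≤ ‖x‖ ^ (-(p / 2)) * (1 - ‖y‖ / ‖x‖) ^ (-(p / 2 / 2)) := by
          gcongr
          exact one_add_mul_le_one_sub_rpow_neg (by linarith) (by positivity)
      _ = (‖x‖ ^ 2 * (1 - ‖y‖ / ‖x‖)) ^ (-(p / 2 / 2)) := by
          rw [Real.mul_rpow (by positivity) (by linarith), sq_rpow_neg_half hx.le]
      _ ≤ (‖x - y‖ ^ 2) ^ (-(p / 2 / 2)) :=
          Real.rpow_le_rpow_of_nonpos (by positivity) hB (by linarith)
      _ = _ := sq_rpow_neg_half hb.le _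
  have hprod : ‖x‖ ^ (-p) ≤ (‖x + y‖ * ‖x - y‖) ^ (-(p / 2)) := by
    rw [← sq_rpow_neg_half hx.le]
    exact Real.rpow_le_rpow_of_nonpos (by positivity) hab (by linarith)
  have hsq : (‖x‖ ^ (-(p / 2))) ^ 2 = ‖x‖ ^ (-p) := by
    rw [← Real.rpow_natCast, ← Real.rpow_mul hx.le]
    congr 1
    push_cast
    ring
  have hdiff : ‖x‖ ^ (-(p / 2)) * (p / 2 / 2 * (‖y‖ / ‖x‖)) ≤
      ‖x - y‖ ^ (-(p / 2)) - ‖x + y‖ ^ (-(p / 2)) := by linarith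
  have hdiff2 := pow_le_pow_left₀ (by positivity) hdiff 2
  rw [rpow_neg_add_rpow_neg ha hb]
  have hL : ‖x‖ ^ (-p) * (p ^ 2 / 16 * (‖y‖ ^ 2 / ‖x‖ ^ 2)) =
      (‖x‖ ^ (-(p / 2)) * (p / 2 / 2 * (‖y‖ / ‖x‖))) ^ 2 := by
    rw [mul_pow, hsq]
    ring
  rw [hL]
  nlinarith

/-- The second difference of `‖·‖ ^ (-p)` at a nonzero point is quadratically small. -/
theorem exists_abs_second_difference_le {x : E} (hx : 0 < ‖x‖) {p : ℝ} (hp : 0 < p) :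
    ∃ C : ℝ, 0 ≤ C ∧ ∀ y : E, ‖y‖ ≤ ‖x‖ / 2 →
      |‖x + y‖ ^ (-p) + ‖x - y‖ ^ (-p) - 2 * ‖x‖ ^ (-p)| ≤ C * ‖y‖ ^ 2 := by
  obtain ⟨L₁, hL₁, h₁⟩ := exists_abs_rpow_neg_sub_le (half_pos hx) (half_pos hp).le
  obtain ⟨L₂, hL₂, h₂⟩ := exists_abs_rpow_neg_sub_le
    (m := ‖x‖ / 2 * (‖x‖ / 2)) (by positivity) (half_pos hp).le
  refine ⟨L₁ ^ 2 * 4 + 2 * L₂, by positivity, fun y h => ?_⟩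
  have ha := half_norm_le_norm_add h
  have hb := half_norm_le_norm_sub h
  have hx2 := half_pos hx
  have hy := norm_nonneg y
  have hdiff : |‖x + y‖ - ‖x - y‖| ≤ 2 * ‖y‖ := by
    calc _ ≤ ‖x + y - (x - y)‖ := abs_norm_sub_norm_le _ _
      _ = ‖y + y‖ := by congr 1; abel
      _ ≤ _ := by linarith [norm_add_le y y]
  have hab : |‖x + y‖ * ‖x - y‖ - ‖x‖ ^ 2| ≤ ‖y‖ ^ 2 := by
    have hid := sq_norm_add_mul_norm_sub x y
    have hcs : ⟪x, y⟫_ℝ ^ 2 ≤ (‖x‖ * ‖y‖) ^ 2 := by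
      rw [← sq_abs]
      exact pow_le_pow_left₀ (abs_nonneg _) (abs_real_inner_le_norm x y) 2
    rw [abs_le]
    constructor
    · have : ‖x‖ ^ 2 - ‖y‖ ^ 2 ≤ ‖x + y‖ * ‖x - y‖ := by
        refine le_of_sq_le_sq ?_ (by positivity)
        rw [hid]
        nlinarith
      linarith
    · have : ‖x + y‖ * ‖x - y‖ ≤ ‖x‖ ^ 2 + ‖y‖ ^ 2 := by
        refine le_of_sq_le_sq ?_ (by positivity)
        rw [hid]
        nlinarith [sq_nonneg ⟪x, y⟫_ℝ]
      linarith
  have e₁ := h₁ _ _ ha hb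
  have e₂ := h₂ (‖x + y‖ * ‖x - y‖) (‖x‖ ^ 2) (by gcongr) (by nlinarith)
  have e₁' : (‖x + y‖ ^ (-(p / 2)) - ‖x - y‖ ^ (-(p / 2))) ^ 2 ≤ L₁ ^ 2 * 4 * ‖y‖ ^ 2 := by
    rw [← sq_abs]
    calc _ ≤ (L₁ * (2 * ‖y‖)) ^ 2 := by
          refine pow_le_pow_left₀ (abs_nonneg _) (e₁.trans ?_) 2
          gcongr
      _ = _ := by ring
  have e₂' := e₂.trans (mul_le_mul_of_nonneg_left hab hL₂)
  rw [sq_rpow_neg_half hx.le, abs_le] at e₂'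
  rw [rpow_neg_add_rpow_neg (hx2.trans_le ha) (hx2.trans_le hb), abs_le]
  have := sq_nonneg (‖x + y‖ ^ (-(p / 2)) - ‖x - y‖ ^ (-(p / 2)))
  have : 0 ≤ L₁ ^ 2 * 4 * ‖y‖ ^ 2 := by positivity
  constructor <;> nlinarith

end SecondDifference

section Kernel

variable {n : ℕ} {ν : Eucl n → ℝ → ℝ}

theorem KernelOK.measurable_radial (hν : KernelOK n ν) (x : Eucl n) :
    Measurable fun y : Eucl n => ν x ‖y‖ :=
  hν.1.comp (measurable_const.prodMk measurable_norm)

theorem ae_ne_zero [Nontrivial (Eucl n)] : ∀ᵐ y : Eucl n, y ≠ 0 := by simp [ae_iff]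

theorem KernelOK.ae_nonneg [Nontrivial (Eucl n)] (hν : KernelOK n ν) (x : Eucl n) :
    ∀ᵐ y : Eucl n, 0 ≤ ν x ‖y‖ := by
  filter_upwards [ae_ne_zero] with y hy
  exact hν.2.1 x _ (norm_pos_iff.2 hy)

/-- A measurable function bounded by a multiple of `min(1,|y|²)` is integrable against `ν`. -/
theorem KernelOK.integrable_mul [Nontrivial (Eucl n)] (hν : KernelOK n ν) (x : Eucl n)
    {g : Eucl n → ℝ} (hg : Measurable g) (C : ℝ)
    (hC : ∀ᵐ y : Eucl n, |g y| ≤ C * min 1 (‖y‖ ^ 2)) :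
    Integrable fun y : Eucl n => g y * ν x ‖y‖ := by
  refine ((hν.2.2 x).const_mul C).mono' (hg.mul (hν.measurable_radial x)).aestronglyMeasurable ?_
  filter_upwards [hν.ae_nonneg x, hC] with y hy hCy
  rw [Real.norm_eq_abs, abs_mul, abs_of_nonneg hy, ← mul_assoc]
  exact mul_le_mul_of_nonneg_right hCy hy

theorem min_one_div_sq_le {R s : ℝ} (hs : 0 ≤ s) :
    min 1 (s / R ^ 2) ≤ (1 + (R ^ 2)⁻¹) * min 1 s := by
  have hR : 0 ≤ (R ^ 2)⁻¹ := by positivity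
  rcases le_total 1 s with h | h
  · rw [min_eq_left h]
    linarith [min_le_left 1 (s / R ^ 2)]
  · rw [min_eq_right h]
    have := min_le_right 1 (s / R ^ 2)
    rw [div_eq_mul_inv] at this ⊢
    nlinarith

theorem KernelOK.integrable_min [Nontrivial (Eucl n)] (hν : KernelOK n ν) (x : Eucl n) (R : ℝ) :
    Integrable fun y : Eucl n => min 1 (‖y‖ ^ 2 / R ^ 2) * ν x ‖y‖ := by
  refine hν.integrable_mul x (by fun_prop) (1 + (R ^ 2)⁻¹) (Filter.Eventually.of_forall fun y => ?_)
  rw [abs_of_nonneg (le_min zero_le_one (by positivity))]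
  exact min_one_div_sq_le (by positivity)

/-- The radial profile `r²/R² ν(x,r)` cut off at radius `R`; its integral is `K(x,R)`. -/
def innerProfile (ν : Eucl n → ℝ → ℝ) (x : Eucl n) (R : ℝ) : ℝ → ℝ :=
  (Iio R).indicator fun r => r ^ 2 / R ^ 2 * ν x r

theorem innerProfile_nonneg (hν : KernelOK n ν) (x : Eucl n) (R : ℝ) {r : ℝ} (hr : 0 < r) :
    0 ≤ innerProfile ν x R r :=
  indicator_apply_nonneg fun _ => mul_nonneg (by positivity) (hν.2.1 x r hr)

theorem innerProfile_of_lt {x : Eucl n} {R r : ℝ} (h : r < R) :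
    innerProfile ν x R r = r ^ 2 / R ^ 2 * ν x r :=
  indicator_of_mem (s := Iio R) h _

theorem innerProfile_of_le {x : Eucl n} {R r : ℝ} (h : R ≤ r) : innerProfile ν x R r = 0 :=
  indicator_of_notMem (s := Iio R) (not_lt.2 h) _

theorem integrable_innerProfile [Nontrivial (Eucl n)] (hν : KernelOK n ν) (x : Eucl n) {R : ℝ}
    (hR : 0 < R) : Integrable fun y : Eucl n => innerProfile ν x R ‖y‖ := by
  have h := (hν.integrable_min x R).indicator (measurableSet_ball (x := (0 : Eucl n)) (ε := R))
  refine h.congr (Filter.Eventually.of_forall fun y => ?_)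
  by_cases hy : ‖y‖ < R
  · have h1 : ‖y‖ ^ 2 / R ^ 2 ≤ 1 := by
      rw [div_le_one (by positivity)]
      gcongr
    simp only [innerProfile_of_lt hy, indicator_of_mem (mem_ball_zero_iff.2 hy), min_eq_right h1]
  · simp only [innerProfile_of_le (not_lt.1 hy),
      indicator_of_notMem (fun h => hy (mem_ball_zero_iff.1 h))]

/-- Weak scaling bounds the full integral `h(x,R)` by its inner part `K(x,R)`. -/
theorem exists_hfun_le_mul_integral_innerProfile (n : ℕ) [Nontrivial (Eucl n)] {cU α : ℝ}
    (hα : 0 < α) :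
    ∃ C : ℝ, 0 ≤ C ∧ ∀ ν : Eucl n → ℝ → ℝ, KernelOK n ν → CondA3 n ν cU α →
      ∀ (x : Eucl n) (R : ℝ), 0 < R →
        hfun n ν x R ≤ C * ∫ y : Eucl n, innerProfile ν x R ‖y‖ := by
  have hlim : Filter.Tendsto (fun t : ℝ => cU * t ^ (-α)) Filter.atTop (nhds 0) := by
    simpa using (tendsto_rpow_neg_atTop hα).const_mul cU
  obtain ⟨t, ht, ht1⟩ := ((hlim.eventually_le_const (u := 1 / 2) (by norm_num)).and
    (Filter.eventually_ge_atTop 1)).exists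
  refine ⟨t ^ 2, by positivity, fun ν hν hA x R hR => ?_⟩
  have ht0 : 0 < t := by linarith
  have hpos : 0 ≤ hfun n ν x (R / t) := by
    refine integral_nonneg_of_ae ?_
    filter_upwards [hν.ae_nonneg x] with y hy
    exact mul_nonneg (le_min zero_le_one (by positivity)) hy
  have hscale := hA x (R / t) t (by positivity) ht1
  rw [mul_div_cancel₀ R ht0.ne'] at hscale
  have hhalf : 2 * hfun n ν x R ≤ hfun n ν x (R / t) := by nlinarith
  have hdiff : hfun n ν x (R / t) ≤
      ∫ y : Eucl n, (min 1 (‖y‖ ^ 2 / R ^ 2) * ν x ‖y‖ + t ^ 2 * innerProfile ν x R ‖y‖) := by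
    refine integral_mono_ae (hν.integrable_min x (R / t))
      ((hν.integrable_min x R).add ((integrable_innerProfile hν x hR).const_mul (t ^ 2))) ?_
    filter_upwards [hν.ae_nonneg x] with y hy
    by_cases hyR : ‖y‖ < R
    · rw [innerProfile_of_lt hyR, ← mul_assoc, ← add_mul]
      refine mul_le_mul_of_nonneg_right ?_ hy
      have h1 : 0 ≤ min 1 (‖y‖ ^ 2 / R ^ 2) := le_min zero_le_one (by positivity)
      have h2 := min_le_right 1 (‖y‖ ^ 2 / (R / t) ^ 2)
      have h3 : ‖y‖ ^ 2 / (R / t) ^ 2 = t ^ 2 * (‖y‖ ^ 2 / R ^ 2) := by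
        field_simp
      linarith
    · have hle := not_lt.1 hyR
      have h1 : 1 ≤ ‖y‖ ^ 2 / R ^ 2 := by
        rw [one_le_div (by positivity)]
        gcongr
      rw [innerProfile_of_le hle, min_eq_left h1, mul_zero, add_zero]
      exact mul_le_mul_of_nonneg_right (min_le_left _ _) hy
  rw [integral_add (hν.integrable_min x R) ((integrable_innerProfile hν x hR).const_mul _),
    integral_const_mul] at hdiff
  change _ ≤ hfun n ν x R + _ at hdiff
  linarith

end Kernel

section Barrier

variable {n : ℕ}

/-- The truncated power `min((s₁/2)^{-p}, |z|^{-p})`. -/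
def barrier (n : ℕ) (s₁ p : ℝ) (z : Eucl n) : ℝ := min ((s₁ / 2) ^ (-p)) (‖z‖ ^ (-p))

theorem measurable_barrier (s₁ p : ℝ) : Measurable (barrier n s₁ p) :=
  measurable_const.min (measurable_norm.pow_const _)

theorem measurable_delta2_barrier (s₁ p : ℝ) (x : Eucl n) :
    Measurable (delta2 n (barrier n s₁ p) x) :=
  (((measurable_barrier s₁ p).comp (measurable_const.add measurable_id)).add
    ((measurable_barrier s₁ p).comp (measurable_const.sub measurable_id))).sub measurable_const

theorem barrier_nonneg {s₁ p : ℝ} (hs : 0 < s₁) (z : Eucl n) : 0 ≤ barrier n s₁ p z :=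
  le_min (by positivity) (by positivity)

theorem barrier_eq {s₁ p : ℝ} (hs : 0 < s₁) (hp : 0 < p) {z : Eucl n} (hz : s₁ / 2 ≤ ‖z‖) :
    barrier n s₁ p z = ‖z‖ ^ (-p) :=
  min_eq_right (Real.rpow_le_rpow_of_nonpos (by positivity) hz (by linarith))

theorem delta2_barrier_eq {s₁ p : ℝ} (hs : 0 < s₁) (hp : 0 < p) {x y : Eucl n} (hx : s₁ < ‖x‖)
    (h : ‖y‖ ≤ ‖x‖ / 2) :
    delta2 n (barrier n s₁ p) x y =
      ‖x + y‖ ^ (-p) + ‖x - y‖ ^ (-p) - 2 * ‖x‖ ^ (-p) := by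
  rw [delta2, barrier_eq hs hp (by linarith : s₁ / 2 ≤ ‖x‖),
    barrier_eq hs hp (by linarith [half_norm_le_norm_add h]),
    barrier_eq hs hp (by linarith [half_norm_le_norm_sub h])]

theorem integrable_delta2_barrier [Nontrivial (Eucl n)] {ν : Eucl n → ℝ → ℝ} (hν : KernelOK n ν)
    {s₁ p : ℝ} (hs : 0 < s₁) (hp : 0 < p) {x : Eucl n} (hx : s₁ < ‖x‖) :
    Integrable fun y : Eucl n => delta2 n (barrier n s₁ p) x y * ν x ‖y‖ := by
  have hx0 : 0 < ‖x‖ := hs.trans hx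
  obtain ⟨C, hC, hCy⟩ := exists_abs_second_difference_le hx0 hp
  set M : ℝ := (s₁ / 2) ^ (-p) with hM
  have hM0 : 0 ≤ M := by positivity
  set ε : ℝ := min 1 (‖x‖ / 2) with hε
  have hε0 : 0 < ε := lt_min one_pos (by linarith)
  refine hν.integrable_mul x (measurable_delta2_barrier s₁ p x) (C + 4 * M / ε ^ 2)
    (Filter.Eventually.of_forall fun y => ?_)
  have hmin : 0 ≤ min 1 (‖y‖ ^ 2) := le_min zero_le_one (by positivity)
  rcases le_total ‖y‖ ε with h | h
  · have hy1 : ‖y‖ ^ 2 ≤ 1 := pow_le_one₀ (norm_nonneg _) (h.trans (min_le_left _ _))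
    have hyx := h.trans (min_le_right _ _)
    rw [delta2_barrier_eq hs hp hx hyx, min_eq_right hy1]
    have : 0 ≤ 4 * M / ε ^ 2 * ‖y‖ ^ 2 := by positivity
    linarith [hCy y hyx]
  · have hbd : |delta2 n (barrier n s₁ p) x y| ≤ 4 * M := by
      have hle : ∀ z : Eucl n, barrier n s₁ p z ≤ M := fun z => min_le_left _ _
      have h0 : ∀ z : Eucl n, 0 ≤ barrier n s₁ p z := barrier_nonneg hs
      rw [delta2, abs_le]
      constructor <;> linarith [hle (x + y), hle (x - y), hle x, h0 (x + y), h0 (x - y), h0 x]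
    have hεy : ε ^ 2 ≤ min 1 (‖y‖ ^ 2) :=
      le_min (pow_le_one₀ hε0.le (min_le_left _ _)) (by gcongr)
    have h1 : 4 * M ≤ 4 * M / ε ^ 2 * min 1 (‖y‖ ^ 2) := by
      rw [div_mul_eq_mul_div, le_div_iff₀ (by positivity)]
      gcongr
    nlinarith [mul_nonneg hC hmin]

/-- The negative part of the second difference lives at scale `R = |x| √(2/p)`. -/
theorem neg_le_delta2_barrier {s₁ p R : ℝ} (hs : 0 < s₁) (hp : 8 ≤ p) {x : Eucl n}
    (hx : s₁ < ‖x‖) (hR : R ^ 2 = 2 / p * ‖x‖ ^ 2) (y : Eucl n) :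
    -(‖x‖ ^ (-p) * (2 * min 1 (‖y‖ ^ 2 / R ^ 2))) ≤ delta2 n (barrier n s₁ p) x y := by
  have hx0 : 0 < ‖x‖ := hs.trans hx
  have hp0 : 0 < p := by linarith
  have hq : ‖y‖ ^ 2 / R ^ 2 = p / 2 * (‖y‖ ^ 2 / ‖x‖ ^ 2) := by
    rw [hR]
    field_simp
  have hglobal : -(‖x‖ ^ (-p) * 2) ≤ delta2 n (barrier n s₁ p) x y := by
    rw [delta2, barrier_eq hs hp0 (by linarith : s₁ / 2 ≤ ‖x‖)]
    linarith [barrier_nonneg (p := p) hs (x + y), barrier_nonneg (p := p) hs (x - y)]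
  rcases le_total 1 (‖y‖ ^ 2 / R ^ 2) with h | h
  · rw [min_eq_left h, mul_one]
    exact hglobal
  · rw [min_eq_right h]
    have hyx : ‖y‖ ≤ ‖x‖ / 2 := by
      rw [hq, ← mul_div_assoc, div_le_one (by positivity)] at h
      refine le_of_sq_le_sq ?_ (by positivity)
      nlinarith [sq_nonneg ‖y‖]
    rw [delta2_barrier_eq hs hp0 hx hyx, hq]
    refine le_trans (le_of_eq ?_) (neg_le_second_difference hx0 hyx hp0)
    ring

/-- In a cone around `x`, up to the scale `R = |x| √(2/p)`, the second difference is large. -/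
theorem le_delta2_barrier {s₁ p R : ℝ} (hs : 0 < s₁) (hp : 8 ≤ p) {x : Eucl n}
    (hx : s₁ < ‖x‖) (hR : R ^ 2 = 2 / p * ‖x‖ ^ 2) {y : Eucl n} (hyR : ‖y‖ < R)
    (hy : y ∈ openCone (‖x‖⁻¹ • x)) :
    ‖x‖ ^ (-p) * (p / 8 * (‖y‖ ^ 2 / R ^ 2)) ≤ delta2 n (barrier n s₁ p) x y := by
  have hx0 : 0 < ‖x‖ := hs.trans hx
  have hp0 : 0 < p := by linarith
  have hq : ‖y‖ ^ 2 / R ^ 2 = p / 2 * (‖y‖ ^ 2 / ‖x‖ ^ 2) := by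
    rw [hR]
    field_simp
  have hyx : ‖y‖ ≤ ‖x‖ / 2 := by
    have hy2 : ‖y‖ ^ 2 ≤ 2 / p * ‖x‖ ^ 2 := hR ▸ pow_le_pow_left₀ (norm_nonneg y) hyR.le 2
    have hp4 : 2 / p ≤ 1 / 4 := by
      rw [div_le_iff₀ hp0]
      linarith
    refine le_of_sq_le_sq ?_ (by positivity)
    nlinarith [sq_nonneg ‖x‖]
  have hinner : 3 / 4 * (‖x‖ * ‖y‖) ≤ ⟪x, y⟫_ℝ := by
    have : 3 / 4 * ‖y‖ < ⟪‖x‖⁻¹ • x, y⟫_ℝ := hy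
    rw [real_inner_smul_left, inv_mul_eq_div, lt_div_iff₀ hx0] at this
    linarith
  rw [delta2_barrier_eq hs hp0 hx hyx, hq]
  refine le_trans (le_of_eq ?_) (le_second_difference_of_inner hx0 hyx hinner hp0)
  ring

end Barrier

/-- **Lemma 4.1** (barrier function). -/
theorem barrier_lemma (n : ℕ) (hn : 1 ≤ n) (lam Lam cU α : ℝ)
    (hlam : 0 < lam) (hlamLam : lam ≤ Lam) (hcU : 0 < cU) (hα : 0 < α) :
    ∃ p : ℝ, 0 < p ∧
      ∀ ν : Eucl n → ℝ → ℝ, KernelOK n ν → CondA n ν cU α →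
        ∀ s₁ : ℝ, 0 < s₁ →
          ∀ x : Eucl n, s₁ < ‖x‖ →
            Integrable (fun y : Eucl n =>
              delta2 n (fun z => min ((s₁ / 2) ^ (-p)) (‖z‖ ^ (-p))) x y * ν x ‖y‖) ∧
            0 ≤ Mminus n lam Lam ν (fun z => min ((s₁ / 2) ^ (-p)) (‖z‖ ^ (-p))) x := by
  have hnontriv : Nontrivial (Eucl n) := by
    have : Nonempty (Fin n) := ⟨⟨0, hn⟩⟩
    infer_instance
  obtain ⟨N, hN⟩ := exists_integral_le_mul_integral_openCone (Eucl n)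
  obtain ⟨C, hC, hh⟩ := exists_hfun_le_mul_integral_innerProfile n (cU := cU) hα
  have hLam : 0 < Lam := hlam.trans_le hlamLam
  set p : ℝ := 8 + 16 * Lam * C * N / lam with hpdef
  have hp : 8 ≤ p := by
    have : 0 ≤ 16 * Lam * C * N / lam := by positivity
    linarith
  have hp0 : 0 < p := by linarith
  refine ⟨p, hp0, fun ν hν hA s₁ hs x hx => ⟨integrable_delta2_barrier hν hs hp0 hx, ?_⟩⟩
  change 0 ≤ ∫ y : Eucl n, (lam * max (delta2 n (barrier n s₁ p) x y) 0 -
    Lam * max (-delta2 n (barrier n s₁ p) x y) 0) * ν x ‖y‖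
  have hx0 : 0 < ‖x‖ := hs.trans hx
  have hint := integrable_delta2_barrier hν hs hp0 hx
  set δ := delta2 n (barrier n s₁ p) x with hδ
  set R : ℝ := √(2 / p) * ‖x‖ with hRdef
  have hR0 : 0 < R := by positivity
  have hR : R ^ 2 = 2 / p * ‖x‖ ^ 2 := by
    rw [hRdef, mul_pow, Real.sq_sqrt (by positivity)]
  set e : Eucl n := ‖x‖⁻¹ • x with he
  have he1 : ‖e‖ = 1 := by simp [he, norm_smul, hx0.ne']
  have hcone := hN (innerProfile ν x R) (fun r hr => innerProfile_nonneg hν x R hr)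
    (integrable_innerProfile hν x hR0) e he1
  have hhR := hh ν hν hA.2.2 x R hR0
  have hprof := (integrable_innerProfile hν x hR0).indicator (measurableSet_openCone e)
  set J : ℝ := ∫ y : Eucl n, (openCone e).indicator (fun z => innerProfile ν x R ‖z‖) y with hJ
  have hJ0 : 0 ≤ J := by
    refine integral_nonneg_of_ae ?_
    filter_upwards [ae_ne_zero] with y hy
    exact indicator_apply_nonneg fun _ => innerProfile_nonneg hν x R (norm_pos_iff.2 hy)
  have hmono : ∫ y : Eucl n, ‖x‖ ^ (-p) *
      (lam * (p / 8) * (openCone e).indicator (fun z => innerProfile ν x R ‖z‖) y -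
        2 * Lam * (min 1 (‖y‖ ^ 2 / R ^ 2) * ν x ‖y‖)) ≤
      ∫ y : Eucl n, (lam * max (δ y) 0 - Lam * max (-δ y) 0) * ν x ‖y‖ := by
    refine integral_mono_ae
      (((hprof.const_mul _).sub ((hν.integrable_min x R).const_mul _)).const_mul _) ?_ ?_
    · have hmeas : Measurable δ := measurable_delta2_barrier s₁ p x
      refine (hint.norm.const_mul (lam + Lam)).mono'
        (Measurable.aestronglyMeasurable ?_) (Filter.Eventually.of_forall fun y => ?_)
      · exact (((hmeas.max measurable_const).const_mul lam).sub
          ((hmeas.neg.max measurable_const).const_mul Lam)).mul (hν.measurable_radial x)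
      · rw [norm_mul, norm_mul, ← mul_assoc]
        refine mul_le_mul_of_nonneg_right ?_ (norm_nonneg _)
        rw [Real.norm_eq_abs, Real.norm_eq_abs]
        rcases le_total 0 (δ y) with h | h
        · rw [max_eq_left h, max_eq_right (by linarith), abs_of_nonneg h, mul_zero, sub_zero,
            abs_of_nonneg (by positivity)]
          nlinarith
        · rw [max_eq_right h, max_eq_left (by linarith), abs_of_nonpos h, mul_zero, zero_sub,
            abs_neg, abs_of_nonneg (mul_nonneg hLam.le (by linarith))]
          nlinarith
    · filter_upwards [hν.ae_nonneg x] with y hy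
      have hxp : 0 ≤ ‖x‖ ^ (-p) := by positivity
      have hm0 : 0 ≤ min 1 (‖y‖ ^ 2 / R ^ 2) := le_min zero_le_one (by positivity)
      have hneg : max (-δ y) 0 ≤ ‖x‖ ^ (-p) * (2 * min 1 (‖y‖ ^ 2 / R ^ 2)) :=
        max_le (by linarith [neg_le_delta2_barrier hs hp hx hR y]) (by positivity)
      have hneg' := mul_le_mul_of_nonneg_right (mul_le_mul_of_nonneg_left hneg hLam.le) hy
      have hpos : ‖x‖ ^ (-p) *
          (p / 8 * (openCone e).indicator (fun z => innerProfile ν x R ‖z‖) y) ≤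
          max (δ y) 0 * ν x ‖y‖ := by
        have hright : 0 ≤ max (δ y) 0 * ν x ‖y‖ := mul_nonneg (le_max_right _ _) hy
        by_cases hye : y ∈ openCone e
        · rw [indicator_of_mem hye]
          by_cases hyR : ‖y‖ < R
          · rw [innerProfile_of_lt hyR, ← mul_assoc, ← mul_assoc]
            refine mul_le_mul_of_nonneg_right ?_ hy
            rw [mul_assoc]
            exact (le_delta2_barrier hs hp hx hR hyR hye).trans (le_max_left _ _)
          · rw [innerProfile_of_le (not_lt.1 hyR)]
            simpa using hright
        · rw [indicator_of_notMem hye]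
          simpa using hright
      have hpos' := mul_le_mul_of_nonneg_left hpos hlam.le
      linarith
  refine le_trans ?_ hmono
  rw [integral_const_mul, integral_sub (hprof.const_mul _)
    ((hν.integrable_min x R).const_mul _), integral_const_mul, integral_const_mul]
  change 0 ≤ ‖x‖ ^ (-p) * (lam * (p / 8) * J - 2 * Lam * hfun n ν x R)
  refine mul_nonneg (by positivity) (sub_nonneg.2 ?_)
  calc 2 * Lam * hfun n ν x R ≤ 2 * Lam * (C * (N * J)) := by
        gcongr
        exact hhR.trans (mul_le_mul_of_nonneg_left hcone hC)
    _ ≤ (lam + 2 * Lam * C * N) * J := by nlinarith [mul_nonneg hlam.le hJ0]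
    _ = lam * (p / 8) * J := by
        rw [hpdef]
        field_simp
        ring
end
end
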